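/- arXiv:1703.06231 — 5 statements merged into one kernel-verified Lean document; each statement's English description precedes it below -/
import Mathlib

section
/- For all networks N_X = (X, r_X), N_Y = (Y, r_Y), N_Z = (Z, r_Z), the partial embedding distance satisfies: (i) nonnegativity, d_PE(N_X, N_Y) ≥ 0; (ii) embedding identity, d_PE(N_X, N_Y) = 0 if and only if there exists an isometric embedding φ : X → Y; and (iii) the triangle inequality, d_PE(N_X, N_Y) ≤ d_PE(N_X, N_Z) + d_PE(N_Z, N_Y). -/
open scoped BigOperators

/-- Network difference of a map `φ : X → Y` between networks `(X, rX)` and `(Y, rY)`: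
`Δ_{X,Y}(φ) = max_{x,x'} |rX x x' - rY (φ x) (φ x')|`. -/
noncomputable def netDiff {X Y : Type*} (rX : X → X → ℝ)
    (rY : Y → Y → ℝ) (φ : X → Y) : ℝ :=
  ⨆ x : X, ⨆ x' : X, |rX x x' - rY (φ x) (φ x')|

/-- Partial embedding distance `d_PE(N_X, N_Y) = min_{φ : X → Y} Δ_{X,Y}(φ)`. -/
noncomputable def dPE {X Y : Type*} (rX : X → X → ℝ) (rY : Y → Y → ℝ) : ℝ :=
  ⨅ φ : X → Y, netDiff rX rY φ

/-- Embedding distance `d_E(N_X, N_Y) = max {d_PE(N_X, N_Y), d_PE(N_Y, N_X)}`. -/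
noncomputable def dE {X Y : Type*} (rX : X → X → ℝ) (rY : Y → Y → ℝ) : ℝ :=
  max (dPE rX rY) (dPE rY rX)

theorem abs_sub_le_netDiff {X Y : Type*} [Finite X] (rX : X → X → ℝ) (rY : Y → Y → ℝ)
    (φ : X → Y) (x x' : X) : |rX x x' - rY (φ x) (φ x')| ≤ netDiff rX rY φ :=
  (le_ciSup (Set.finite_range fun x' ↦ |rX x x' - rY (φ x) (φ x')|).bddAbove x').trans
    (le_ciSup (Set.finite_range fun x ↦ ⨆ x', |rX x x' - rY (φ x) (φ x')|).bddAbove x)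

theorem netDiff_nonneg {X Y : Type*} (rX : X → X → ℝ) (rY : Y → Y → ℝ) (φ : X → Y) :
    0 ≤ netDiff rX rY φ :=
  Real.iSup_nonneg fun _ ↦ Real.iSup_nonneg fun _ ↦ abs_nonneg _

theorem netDiff_eq_zero_iff {X Y : Type*} [Finite X] (rX : X → X → ℝ) (rY : Y → Y → ℝ)
    (φ : X → Y) : netDiff rX rY φ = 0 ↔ ∀ x x', rX x x' = rY (φ x) (φ x') := by
  refine ⟨fun h x x' ↦ ?_, fun h ↦ by simp [netDiff, ← h]⟩
  have hle := abs_sub_le_netDiff rX rY φ x x'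
  rw [h] at hle
  exact sub_eq_zero.mp (abs_nonpos_iff.mp hle)

theorem netDiff_comp_le {X Y Z : Type*} [Finite X] [Nonempty X] [Finite Z]
    (rX : X → X → ℝ) (rY : Y → Y → ℝ) (rZ : Z → Z → ℝ) (φ : X → Z) (ψ : Z → Y) :
    netDiff rX rY (ψ ∘ φ) ≤ netDiff rX rZ φ + netDiff rZ rY ψ :=
  ciSup_le fun x ↦ ciSup_le fun x' ↦
    (abs_sub_le _ (rZ (φ x) (φ x')) _).trans
      (add_le_add (abs_sub_le_netDiff rX rZ φ x x') (abs_sub_le_netDiff rZ rY ψ (φ x) (φ x')))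

theorem dPE_nonneg {X Y : Type*} (rX : X → X → ℝ) (rY : Y → Y → ℝ) : 0 ≤ dPE rX rY :=
  Real.iInf_nonneg fun φ ↦ netDiff_nonneg rX rY φ

theorem dPE_le_netDiff {X Y : Type*} (rX : X → X → ℝ) (rY : Y → Y → ℝ) (φ : X → Y) :
    dPE rX rY ≤ netDiff rX rY φ :=
  ciInf_le ⟨0, Set.forall_mem_range.mpr fun ψ ↦ netDiff_nonneg rX rY ψ⟩ φ

theorem exists_netDiff_eq_dPE {X Y : Type*} [Finite X] [Finite Y] [Nonempty Y]
    (rX : X → X → ℝ) (rY : Y → Y → ℝ) : ∃ φ : X → Y, netDiff rX rY φ = dPE rX rY :=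
  exists_eq_ciInf_of_finite

/-- the partial embedding distance is nonnegative, vanishes exactly
when there is an isometric embedding, and satisfies the triangle inequality. -/
theorem partial_embedding_distance_is_embedding_metric
    {X Y Z : Type*} [Fintype X] [Nonempty X] [Fintype Y] [Nonempty Y]
    [Fintype Z] [Nonempty Z]
(rX : X → X → ℝ) (rY : Y → Y → ℝ)
    (hX0 : ∀ x x', 0 ≤ rX x x') (hXsymm : ∀ x x', rX x x' = rX x' x)
    (hXid : ∀ x x', rX x x' = 0 ↔ x = x')
    (hY0 : ∀ y y', 0 ≤ rY y y') (hYsymm : ∀ y y', rY y y' = rY y' y)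
    (hYid : ∀ y y', rY y y' = 0 ↔ y = y')
    (rZ : Z → Z → ℝ)
    (hZ0 : ∀ z z', 0 ≤ rZ z z') (hZsymm : ∀ z z', rZ z z' = rZ z' z)
    (hZid : ∀ z z', rZ z z' = 0 ↔ z = z') :
    0 ≤ dPE rX rY ∧
    (dPE rX rY = 0 ↔ ∃ φ : X → Y, ∀ x x', rX x x' = rY (φ x) (φ x')) ∧
    dPE rX rY ≤ dPE rX rZ + dPE rZ rY := by
  obtain ⟨φ, hφ⟩ := exists_netDiff_eq_dPE rX rY
  obtain ⟨α, hα⟩ := exists_netDiff_eq_dPE rX rZ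
  obtain ⟨β, hβ⟩ := exists_netDiff_eq_dPE rZ rY
  refine ⟨dPE_nonneg rX rY, ⟨fun h ↦ ⟨φ, ?_⟩, ?_⟩, ?_⟩
  · exact (netDiff_eq_zero_iff rX rY φ).mp (hφ.trans h)
  · rintro ⟨ψ, hψ⟩
    refine le_antisymm ?_ (dPE_nonneg rX rY)
    exact (dPE_le_netDiff rX rY ψ).trans_eq ((netDiff_eq_zero_iff rX rY ψ).mpr hψ)
  · rw [← hα, ← hβ]
    exact (dPE_le_netDiff rX rY (β ∘ α)).trans (netDiff_comp_le rX rY rZ α β)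
end

section
/- For all networks N_X = (X, r_X) and N_Y = (Y, r_Y), the network distance admits the reformulation d_C(N_X, N_Y) = min over all pairs of maps φ : X → Y and ψ : Y → X of max{Δ_{X,Y}(φ), Δ_{Y,X}(ψ), δ_{X,Y}(φ, ψ)}. -/
open scoped BigOperators

/-- A correspondence between `X` and `Y`: both projections are surjective. -/
def IsCorrespondence {X Y : Type*} (C : Set (X × Y)) : Prop :=
  (∀ x : X, ∃ y : Y, (x, y) ∈ C) ∧ (∀ y : Y, ∃ x : X, (x, y) ∈ C)

/-- `Γ_{X,Y}(C) = max_{(x,y),(x',y') ∈ C} |rX x x' - rY y y'|`. -/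
noncomputable def GammaDiff {X Y : Type*} (rX : X → X → ℝ) (rY : Y → Y → ℝ)
    (C : Set (X × Y)) : ℝ :=
  sSup { t : ℝ | ∃ p ∈ C, ∃ q ∈ C, t = |rX p.1 q.1 - rY p.2 q.2| }

/-- Network distance `d_C(N_X, N_Y) = min over correspondences C of Γ_{X,Y}(C)`. -/
noncomputable def dC {X Y : Type*} (rX : X → X → ℝ) (rY : Y → Y → ℝ) : ℝ :=
  sInf { g : ℝ | ∃ C : Set (X × Y), IsCorrespondence C ∧ g = GammaDiff rX rY C }

/-- `δ_{X,Y}(φ, ψ) = max_{x ∈ X, y ∈ Y} |rX x (ψ y) - rY (φ x) y|`. -/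
noncomputable def deltaDiff {X Y : Type*} (rX : X → X → ℝ) (rY : Y → Y → ℝ)
    (φ : X → Y) (ψ : Y → X) : ℝ :=
  ⨆ x : X, ⨆ y : Y, |rX x (ψ y) - rY (φ x) y|

theorem ciSup₂_le_iff_of_finite {α β : Type*} [Finite α] [Nonempty α] [Finite β] [Nonempty β]
    {f : α → β → ℝ} {t : ℝ} : (⨆ a, ⨆ b, f a b) ≤ t ↔ ∀ a b, f a b ≤ t := by
  rw [ciSup_le_iff (Set.finite_range _).bddAbove]
  exact forall_congr' fun a => ciSup_le_iff (Set.finite_range _).bddAbove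

theorem IsCorrespondence.nonempty {X Y : Type*} [Nonempty X] {C : Set (X × Y)}
    (hC : IsCorrespondence C) : C.Nonempty :=
  let ⟨y, hy⟩ := hC.1 (Classical.arbitrary X)
  ⟨(_, y), hy⟩

theorem GammaDiff_le_iff {X Y : Type*} [Finite X] [Finite Y] (rX : X → X → ℝ) (rY : Y → Y → ℝ)
    {C : Set (X × Y)} (hC : C.Nonempty) {t : ℝ} :
    GammaDiff rX rY C ≤ t ↔ ∀ p ∈ C, ∀ q ∈ C, |rX p.1 q.1 - rY p.2 q.2| ≤ t := by
  obtain ⟨p₀, hp₀⟩ := hC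
  have hfin : {t : ℝ | ∃ p ∈ C, ∃ q ∈ C, t = |rX p.1 q.1 - rY p.2 q.2|}.Finite := by
    refine (Set.finite_range fun pq : (X × Y) × (X × Y) =>
      |rX pq.1.1 pq.2.1 - rY pq.1.2 pq.2.2|).subset ?_
    rintro _ ⟨p, -, q, -, rfl⟩
    exact ⟨(p, q), rfl⟩
  rw [GammaDiff, csSup_le_iff hfin.bddAbove ⟨_, p₀, hp₀, p₀, hp₀, rfl⟩]
  constructor
  · exact fun h p hp q hq => h _ ⟨p, hp, q, hq, rfl⟩
  · rintro h _ ⟨p, hp, q, hq, rfl⟩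
    exact h p hp q hq

/-- The union of the graph of `φ` and the transposed graph of `ψ` is a correspondence. -/
theorem isCorrespondence_graph_union {X Y : Type*} (φ : X → Y) (ψ : Y → X) :
    IsCorrespondence {p : X × Y | p.2 = φ p.1 ∨ p.1 = ψ p.2} :=
  ⟨fun x => ⟨φ x, Or.inl rfl⟩, fun y => ⟨ψ y, Or.inr rfl⟩⟩

/-- reformulation of the network distance via pairs of maps. -/
theorem network_distance_eq_min_over_map_pairs
    {X Y : Type*} [Fintype X] [Nonempty X] [Fintype Y] [Nonempty Y]
(rX : X → X → ℝ) (rY : Y → Y → ℝ)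
    (hX0 : ∀ x x', 0 ≤ rX x x') (hXsymm : ∀ x x', rX x x' = rX x' x)
    (hXid : ∀ x x', rX x x' = 0 ↔ x = x')
    (hY0 : ∀ y y', 0 ≤ rY y y') (hYsymm : ∀ y y', rY y y' = rY y' y)
    (hYid : ∀ y y', rY y y' = 0 ↔ y = y') :
    dC rX rY =
      ⨅ φ : X → Y, ⨅ ψ : Y → X,
        max (netDiff rX rY φ) (max (netDiff rY rX ψ) (deltaDiff rX rY φ ψ)) := by
  apply le_antisymm
  · refine le_ciInf fun φ => le_ciInf fun ψ => ?_
    have hC := isCorrespondence_graph_union φ ψ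
    have hfin : {g : ℝ | ∃ C : Set (X × Y), IsCorrespondence C ∧ g = GammaDiff rX rY C}.Finite := by
      refine (Set.finite_range fun C : Set (X × Y) => GammaDiff rX rY C).subset ?_
      rintro _ ⟨C, -, rfl⟩
      exact ⟨C, rfl⟩
    refine (csInf_le hfin.bddBelow ⟨_, hC, rfl⟩).trans ?_
    rw [GammaDiff_le_iff rX rY hC.nonempty]
    set m := max (netDiff rX rY φ) (max (netDiff rY rX ψ) (deltaDiff rX rY φ ψ))
    have hφ : ∀ x x', |rX x x' - rY (φ x) (φ x')| ≤ m :=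
      ciSup₂_le_iff_of_finite.1 (le_max_left _ _)
    have hψ : ∀ y y', |rY y y' - rX (ψ y) (ψ y')| ≤ m :=
      ciSup₂_le_iff_of_finite.1 ((le_max_left _ _).trans (le_max_right _ _))
    have hδ : ∀ x y, |rX x (ψ y) - rY (φ x) y| ≤ m :=
      ciSup₂_le_iff_of_finite.1 ((le_max_right _ _).trans (le_max_right _ _))
    rintro ⟨x, y⟩ hp ⟨x', y'⟩ hq
    change y = φ x ∨ x = ψ y at hp
    change y' = φ x' ∨ x' = ψ y' at hq
    rcases hp with rfl | rfl <;> rcases hq with rfl | rfl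
    · exact hφ x x'
    · exact hδ x y'
    · change |rX (ψ y) x' - rY y (φ x')| ≤ m
      rw [hXsymm, hYsymm]
      exact hδ x' y
    · exact (abs_sub_comm _ _).trans_le (hψ y y')
  · refine le_csInf ⟨_, Set.univ, ⟨fun x => ⟨Classical.arbitrary Y, trivial⟩,
      fun y => ⟨Classical.arbitrary X, trivial⟩⟩, rfl⟩ ?_
    rintro _ ⟨C, hC, rfl⟩
    choose φ hφ using hC.1
    choose ψ hψ using hC.2
    have hΓ := (GammaDiff_le_iff rX rY hC.nonempty).1 le_rfl
    refine (ciInf_le (Set.finite_range _).bddBelow φ).trans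
      ((ciInf_le (Set.finite_range _).bddBelow ψ).trans (max_le ?_ (max_le ?_ ?_)))
    · exact ciSup₂_le_iff_of_finite.2 fun x x' => hΓ _ (hφ x) _ (hφ x')
    · exact ciSup₂_le_iff_of_finite.2 fun y y' =>
        (abs_sub_comm _ _).trans_le (hΓ _ (hψ y) _ (hψ y'))
    · exact ciSup₂_le_iff_of_finite.2 fun x y => hΓ _ (hφ x) _ (hψ y)
end

section
/- For all networks N_X = (X, r_X) and N_Y = (Y, r_Y), the embedding distance is a lower bound on the network distance: d_E(N_X, N_Y) ≤ d_C(N_X, N_Y). -/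
open scoped BigOperators

theorem netDiff_le {X Y : Type*} [Nonempty X] {rX : X → X → ℝ} {rY : Y → Y → ℝ} {φ : X → Y}
    {a : ℝ} (h : ∀ x x', |rX x x' - rY (φ x) (φ x')| ≤ a) : netDiff rX rY φ ≤ a :=
  ciSup_le fun x => ciSup_le (h x)

theorem isCorrespondence_univ {X Y : Type*} [Nonempty X] [Nonempty Y] :
    IsCorrespondence (Set.univ : Set (X × Y)) :=
  ⟨fun _ => ⟨Classical.arbitrary Y, trivial⟩, fun _ => ⟨Classical.arbitrary X, trivial⟩⟩

theorem abs_sub_le_GammaDiff {X Y : Type*} [Finite X] [Finite Y] (rX : X → X → ℝ)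
    (rY : Y → Y → ℝ) {C : Set (X × Y)} {x x' : X} {y y' : Y} (h : (x, y) ∈ C)
    (h' : (x', y') ∈ C) : |rX x x' - rY y y'| ≤ GammaDiff rX rY C := by
  refine le_csSup (Set.Finite.bddAbove ?_) ⟨_, h, _, h', rfl⟩
  refine (Set.finite_range fun p : (X × Y) × (X × Y) =>
    |rX p.1.1 p.2.1 - rY p.1.2 p.2.2|).subset ?_
  rintro _ ⟨p, -, q, -, rfl⟩
  exact ⟨(p, q), rfl⟩

/-- the embedding distance lower bounds the network distance. -/
theorem embedding_distance_le_network_distance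
    {X Y : Type*} [Fintype X] [Nonempty X] [Fintype Y] [Nonempty Y]
(rX : X → X → ℝ) (rY : Y → Y → ℝ)
    (hX0 : ∀ x x', 0 ≤ rX x x') (hXsymm : ∀ x x', rX x x' = rX x' x)
    (hXid : ∀ x x', rX x x' = 0 ↔ x = x')
    (hY0 : ∀ y y', 0 ≤ rY y y') (hYsymm : ∀ y y', rY y y' = rY y' y)
    (hYid : ∀ y y', rY y y' = 0 ↔ y = y') :
    dE rX rY ≤ dC rX rY := by
  refine le_csInf ⟨_, Set.univ, isCorrespondence_univ, rfl⟩ ?_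
  rintro _ ⟨C, ⟨hX, hY⟩, rfl⟩
  choose φ hφ using hX
  choose ψ hψ using hY
  refine max_le ((dPE_le_netDiff rX rY φ).trans (netDiff_le fun x x' => ?_))
    ((dPE_le_netDiff rY rX ψ).trans (netDiff_le fun y y' => ?_))
  · exact abs_sub_le_GammaDiff rX rY (hφ x) (hφ x')
  · rw [abs_sub_comm]
    exact abs_sub_le_GammaDiff rX rY (hψ y) (hψ y')
end

section
/- For every network N_X = (X, r_X), the induced dissimilarity s_X on the standard simplex S_X is a semimetric extending r_X: for all p, m ∈ S_X, (i) s_X(p, m) ≥ 0; (ii) s_X(p, m) = s_X(m, p); (iii) s_X(p, m) = 0 if and only if p = m; and (iv) for all nodes i, j ∈ X, s_X(e_i, e_j) = r_X(i, j). -/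
open scoped BigOperators

/-- The vertex `e_i` of the standard simplex `S_X ⊆ ℝ^X`. -/
def vertex {X : Type*} [DecidableEq X] (i : X) : X → ℝ :=
  fun j => if j = i then 1 else 0

/-- A flow from `p` to `m`: an antisymmetric `W : X × X → ℝ` with
`m i = p i + ∑ j, W j i` for every `i`. -/
def IsFlow {X : Type*} [Fintype X] (p m : X → ℝ) (W : X → X → ℝ) : Prop :=
  (∀ i j, W i j = - W j i) ∧ ∀ i, m i = p i + ∑ j, W j i

/-- The size `∑_{i<j} |W(i,j)|` of a flow. -/
noncomputable def flowSize {X : Type*} [Fintype X] [LinearOrder X] (W : X → X → ℝ) : ℝ :=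
  ∑ i, ∑ j, if i < j then |W i j| else 0

/-- The weighted cost `∑_{i<j} |W(i,j)| * r i j` of a flow. -/
noncomputable def flowCost {X : Type*} [Fintype X] [LinearOrder X]
    (r : X → X → ℝ) (W : X → X → ℝ) : ℝ :=
  ∑ i, ∑ j, if i < j then |W i j| * r i j else 0

/-- The minimal transformation cost `c_X(p, m)`: the infimum of the sizes of
all flows from `p` to `m`. -/
noncomputable def minCost {X : Type*} [Fintype X] [LinearOrder X] (p m : X → ℝ) : ℝ :=
  sInf { s : ℝ | ∃ W : X → X → ℝ, IsFlow p m W ∧ flowSize W = s }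

/-- The induced dissimilarity `s_X(p, m)`: the infimum of the weighted costs of
flows from `p` to `m` whose size equals `c_X(p, m)`. -/
noncomputable def sDis {X : Type*} [Fintype X] [LinearOrder X]
    (r : X → X → ℝ) (p m : X → ℝ) : ℝ :=
  sInf { t : ℝ | ∃ W : X → X → ℝ,
    IsFlow p m W ∧ flowSize W = minCost p m ∧ flowCost r W = t }

/-- Half of the `ℓ¹` distance between `p` and `m`. -/
noncomputable def halfL1 {X : Type*} [Fintype X] (p m : X → ℝ) : ℝ :=
  (∑ i, |m i - p i|) / 2

theorem sum_lt_eq_half_sum {X : Type*} [Fintype X] [LinearOrder X] (f : X → X → ℝ)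
    (hsymm : ∀ i j, f i j = f j i) (hdiag : ∀ i, f i i = 0) :
    (∑ i, ∑ j, if i < j then f i j else 0) = (∑ i, ∑ j, f i j) / 2 := by
  have hsplit : ∑ i, ∑ j, f i j =
      (∑ i, ∑ j, if i < j then f i j else 0) + ∑ i, ∑ j, if j < i then f i j else 0 := by
    simp only [← Finset.sum_add_distrib]
    refine Finset.sum_congr rfl fun i _ => Finset.sum_congr rfl fun j _ => ?_
    rcases lt_trichotomy i j with h | h | h
    · simp [h, h.not_gt]
    · simp [h, hdiag]
    · simp [h, h.not_gt]
  have hswap : (∑ i, ∑ j, if j < i then f i j else 0) =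
      ∑ i, ∑ j, if i < j then f i j else 0 := by
    rw [Finset.sum_comm]
    simp only [hsymm]
  rw [hsplit, hswap]
  ring

section Flow

variable {X : Type*} [Fintype X] {p m : X → ℝ} {W : X → X → ℝ}

theorem IsFlow.abs_symm (h : IsFlow p m W) (i j : X) : |W i j| = |W j i| := by
  rw [h.1 i j, abs_neg]

theorem IsFlow.apply_self (h : IsFlow p m W) (i : X) : W i i = 0 := by
  linarith [h.1 i i]

theorem IsFlow.sum_apply (h : IsFlow p m W) (i : X) : ∑ j, W j i = m i - p i := by
  linarith [h.2 i]

theorem IsFlow.neg (h : IsFlow p m W) : IsFlow m p (-W) := by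
  refine ⟨fun i j => ?_, fun i => ?_⟩
  · simp [h.1 i j]
  · simp [h.sum_apply]

theorem IsFlow.abs_sub_le (h : IsFlow p m W) (i : X) : |m i - p i| ≤ ∑ j, |W j i| := by
  rw [← h.sum_apply]
  exact Finset.abs_sum_le_sum_abs _ _

theorem isFlow_zero (p : X → ℝ) : IsFlow p p 0 := by
  constructor <;> simp

theorem halfL1_pos (h : p ≠ m) : 0 < halfL1 p m := by
  obtain ⟨i, hi⟩ := Function.ne_iff.1 h
  exact half_pos (Finset.sum_pos' (fun _ _ => abs_nonneg _)
    ⟨i, Finset.mem_univ i, abs_pos.2 (sub_ne_zero.2 hi.symm)⟩)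

variable [LinearOrder X]

theorem flowSize_neg (W : X → X → ℝ) : flowSize (-W) = flowSize W := by
  simp [flowSize]

theorem flowCost_neg (r W : X → X → ℝ) : flowCost r (-W) = flowCost r W := by
  simp [flowCost]

theorem IsFlow.flowSize_eq (h : IsFlow p m W) : flowSize W = (∑ i, ∑ j, |W j i|) / 2 := by
  rw [Finset.sum_comm]
  exact sum_lt_eq_half_sum (fun i j => |W i j|) h.abs_symm (by simp [h.apply_self])

theorem IsFlow.halfL1_le_flowSize (h : IsFlow p m W) : halfL1 p m ≤ flowSize W := by
  rw [h.flowSize_eq, halfL1]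
  gcongr with i
  exact h.abs_sub_le i

/-- In a flow of minimal size nothing is cancelled at any node. -/
theorem IsFlow.sum_abs_eq (h : IsFlow p m W) (hW : flowSize W = halfL1 p m) (i : X) :
    ∑ j, |W j i| = |m i - p i| := by
  have hsum : ∑ i, |m i - p i| = ∑ i, ∑ j, |W j i| := by
    rw [h.flowSize_eq, halfL1] at hW
    linarith
  exact ((Finset.sum_eq_sum_iff_of_le fun i _ => h.abs_sub_le i).1 hsum i
    (Finset.mem_univ i)).symm

/-- The excess mass is distributed proportionally over the deficits. -/
theorem exists_isFlow_flowSize_eq (hp : p ∈ stdSimplex ℝ X) (hm : m ∈ stdSimplex ℝ X) :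
    ∃ W, IsFlow p m W ∧ flowSize W = halfL1 p m := by
  set a : X → ℝ := fun i => max (p i - m i) 0
  set b : X → ℝ := fun i => max (m i - p i) 0
  have ha : ∀ i, 0 ≤ a i := fun i => le_max_right _ _
  have hb : ∀ i, 0 ≤ b i := fun i => le_max_right _ _
  have hsub : ∀ i, b i - a i = m i - p i := fun i => by
    simp only [a, b]
    rcases le_total (p i) (m i) with h | h
    · rw [max_eq_left (by linarith), max_eq_right (by linarith)]; ring
    · rw [max_eq_right (by linarith), max_eq_left (by linarith)]; ring
  have hadd : ∀ i, b i + a i = |m i - p i| := fun i => by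
    simp only [a, b]
    rcases le_total (p i) (m i) with h | h
    · rw [max_eq_left (by linarith), max_eq_right (by linarith), abs_of_nonneg (by linarith)]
      ring
    · rw [max_eq_right (by linarith), max_eq_left (by linarith), abs_of_nonpos (by linarith)]
      ring
  have hab : ∑ i, b i = ∑ i, a i := by
    rw [← sub_eq_zero, ← Finset.sum_sub_distrib]
    simp only [hsub, Finset.sum_sub_distrib]
    rw [hp.2, hm.2, sub_self]
  have hT : halfL1 p m = ∑ i, a i := by
    rw [halfL1]
    simp only [← hadd, Finset.sum_add_distrib]
    rw [hab]
    ring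
  rcases eq_or_ne (∑ i, a i) 0 with h0 | h0
  · have hpm : p = m := by
      have haz := (Finset.sum_eq_zero_iff_of_nonneg fun i _ => ha i).1 h0
      have hbz := (Finset.sum_eq_zero_iff_of_nonneg fun i _ => hb i).1 (hab.trans h0)
      funext i
      linarith [hsub i, haz i (Finset.mem_univ i), hbz i (Finset.mem_univ i)]
    subst hpm
    exact ⟨0, isFlow_zero p, by simp [flowSize, halfL1]⟩
  set T := ∑ i, a i
  have hTpos : 0 < T := lt_of_le_of_ne (Finset.sum_nonneg fun i _ => ha i) h0.symm
  have hflow : IsFlow p m fun i j => (a i * b j - a j * b i) / T := by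
    refine ⟨fun i j => by ring, fun i => ?_⟩
    rw [← Finset.sum_div, Finset.sum_sub_distrib, ← Finset.sum_mul, ← Finset.mul_sum, hab,
      ← sub_eq_iff_eq_add', ← hsub i]
    field_simp
    exact sub_mul _ _ _
  refine ⟨_, hflow, le_antisymm ?_ hflow.halfL1_le_flowSize⟩
  rw [hflow.flowSize_eq, hT, div_le_iff₀ two_pos]
  calc ∑ i, ∑ j, |(a j * b i - a i * b j) / T|
      ≤ ∑ i, ∑ j, (a j * b i + a i * b j) / T := by
        gcongr with i _ j
        rw [abs_div, abs_of_pos hTpos]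
        gcongr
        have h1 := mul_nonneg (ha j) (hb i)
        have h2 := mul_nonneg (ha i) (hb j)
        rw [abs_le]
        constructor <;> linarith
    _ = T * 2 := by
        simp only [← Finset.sum_div, Finset.sum_add_distrib, ← Finset.sum_mul,
          ← Finset.mul_sum]
        rw [hab, div_eq_iff h0]
        change T * T + T * T = T * 2 * T
        ring

theorem minCost_eq_halfL1 (hp : p ∈ stdSimplex ℝ X) (hm : m ∈ stdSimplex ℝ X) :
    minCost p m = halfL1 p m := by
  refine IsLeast.csInf_eq ⟨exists_isFlow_flowSize_eq hp hm, ?_⟩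
  rintro _ ⟨W, hW, rfl⟩
  exact hW.halfL1_le_flowSize

theorem minCost_comm (p m : X → ℝ) : minCost p m = minCost m p := by
  unfold minCost
  congr 1
  ext s
  constructor <;> rintro ⟨W, hW, hs⟩ <;> exact ⟨-W, hW.neg, by rw [flowSize_neg, hs]⟩

theorem sDis_comm (r : X → X → ℝ) (p m : X → ℝ) : sDis r p m = sDis r m p := by
  unfold sDis
  congr 1
  ext t
  constructor <;> rintro ⟨W, hW, hs, ht⟩ <;>
    exact ⟨-W, hW.neg, by rw [flowSize_neg, hs, minCost_comm], by rw [flowCost_neg, ht]⟩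

theorem flowCost_nonneg {r : X → X → ℝ} (hr : ∀ x x', 0 ≤ r x x') (W : X → X → ℝ) :
    0 ≤ flowCost r W := by
  refine Finset.sum_nonneg fun i _ => Finset.sum_nonneg fun j _ => ?_
  split_ifs
  · exact mul_nonneg (abs_nonneg _) (hr i j)
  · exact le_rfl

theorem sDis_nonneg {r : X → X → ℝ} (hr : ∀ x x', 0 ≤ r x x') (p m : X → ℝ) :
    0 ≤ sDis r p m := by
  refine Real.sInf_nonneg ?_
  rintro _ ⟨W, -, -, rfl⟩
  exact flowCost_nonneg hr W

theorem le_sDis {r : X → X → ℝ} (hp : p ∈ stdSimplex ℝ X) (hm : m ∈ stdSimplex ℝ X) {c : ℝ}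
    (h : ∀ W, IsFlow p m W → flowSize W = halfL1 p m → c ≤ flowCost r W) :
    c ≤ sDis r p m := by
  obtain ⟨W₀, hW₀, hs₀⟩ := exists_isFlow_flowSize_eq hp hm
  have hmin := minCost_eq_halfL1 hp hm
  refine le_csInf ⟨_, W₀, hW₀, hs₀.trans hmin.symm, rfl⟩ ?_
  rintro _ ⟨W, hW, hs, rfl⟩
  exact h W hW (hs.trans hmin)

theorem sDis_le_flowCost {r : X → X → ℝ} (hr : ∀ x x', 0 ≤ r x x')
    (hp : p ∈ stdSimplex ℝ X) (hm : m ∈ stdSimplex ℝ X)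
    (hW : IsFlow p m W) (hs : flowSize W = halfL1 p m) :
    sDis r p m ≤ flowCost r W := by
  refine csInf_le ⟨0, ?_⟩ ⟨W, hW, hs.trans (minCost_eq_halfL1 hp hm).symm, rfl⟩
  rintro _ ⟨V, -, -, rfl⟩
  exact flowCost_nonneg hr V

theorem sDis_self {r : X → X → ℝ} (hr : ∀ x x', 0 ≤ r x x') (hp : p ∈ stdSimplex ℝ X) :
    sDis r p p = 0 := by
  refine le_antisymm ?_ (sDis_nonneg hr p p)
  simpa [flowCost] using
    sDis_le_flowCost hr hp hp (isFlow_zero p) (by simp [flowSize, halfL1])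

theorem mul_flowSize_le_flowCost {r : X → X → ℝ} {c : ℝ} (h : ∀ i j, i ≠ j → c ≤ r i j)
    (W : X → X → ℝ) : c * flowSize W ≤ flowCost r W := by
  simp only [flowSize, flowCost, Finset.mul_sum]
  gcongr with i _ j
  split_ifs with hij
  · rw [mul_comm]
    exact mul_le_mul_of_nonneg_left (h i j hij.ne) (abs_nonneg _)
  · simp

end Flow

theorem exists_pos_forall_ne_le {X : Type*} [Fintype X] {r : X → X → ℝ}
    (h : ∀ i j, i ≠ j → 0 < r i j) : ∃ c > 0, ∀ i j, i ≠ j → c ≤ r i j := by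
  classical
  rcases isEmpty_or_nonempty (X × X) with hX | hX
  · exact ⟨1, one_pos, fun i j => (hX.false (i, j)).elim⟩
  obtain ⟨x, hx⟩ := Finite.exists_min fun x : X × X => if x.1 = x.2 then 1 else r x.1 x.2
  refine ⟨_, ?_, fun i j hij => (hx (i, j)).trans_eq (if_neg hij)⟩
  split_ifs with hxx
  · exact one_pos
  · exact h _ _ hxx

section Vertex

variable {X : Type*} [Fintype X]

theorem vertex_mem_stdSimplex [DecidableEq X] (i : X) : vertex i ∈ stdSimplex ℝ X := by
  refine ⟨fun j => ?_, by simp [vertex]⟩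
  unfold vertex
  split_ifs <;> norm_num

theorem halfL1_vertex [DecidableEq X] {i j : X} (hij : i ≠ j) :
    halfL1 (vertex i) (vertex j) = 1 := by
  have h : ∀ k, |vertex j k - vertex i k| = vertex j k + vertex i k := fun k => by
    unfold vertex
    split_ifs with h1 h2 <;> simp_all
  simp only [halfL1, h, Finset.sum_add_distrib, (vertex_mem_stdSimplex _).2]
  norm_num

theorem IsFlow.flowCost_vertex [LinearOrder X] {r W : X → X → ℝ}
    (hr : ∀ x x', r x x' = r x' x) {i j : X} (hij : i ≠ j)
    (hW : IsFlow (vertex i) (vertex j) W)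
    (hs : flowSize W = halfL1 (vertex i) (vertex j)) : flowCost r W = r i j := by
  have hzero : ∀ k, k ≠ i → k ≠ j → ∀ l, W l k = 0 := fun k hki hkj l => by
    have h := hW.sum_abs_eq hs k
    simp only [vertex, hki, hkj, if_false, sub_self, abs_zero] at h
    exact abs_eq_zero.1
      ((Finset.sum_eq_zero_iff_of_nonneg fun _ _ => abs_nonneg _).1 h l (Finset.mem_univ l))
  have hterm : ∀ k l, k < l → |W k l| * r k l = |W k l| * r i j := fun k l hkl => by
    by_cases hl : l ≠ i ∧ l ≠ j
    · simp [hzero l hl.1 hl.2 k]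
    by_cases hk : k ≠ i ∧ k ≠ j
    · simp [hW.1 k l, hzero k hk.1 hk.2 l]
    have hl' : l = i ∨ l = j := by tauto
    have hk' : k = i ∨ k = j := by tauto
    rcases hl' with rfl | rfl <;> rcases hk' with rfl | rfl
    · exact (lt_irrefl _ hkl).elim
    · rw [hr]
    · rfl
    · exact (lt_irrefl _ hkl).elim
  calc flowCost r W = flowSize W * r i j := by
        simp only [flowCost, flowSize, Finset.sum_mul]
        refine Finset.sum_congr rfl fun k _ => Finset.sum_congr rfl fun l _ => ?_
        split_ifs with hkl
        · exact hterm k l hkl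
        · simp
    _ = r i j := by rw [hs, halfL1_vertex hij, one_mul]

theorem sDis_vertex [LinearOrder X] {r : X → X → ℝ} (hr0 : ∀ x x', 0 ≤ r x x')
    (hr : ∀ x x', r x x' = r x' x) {i j : X} (hij : i ≠ j) :
    sDis r (vertex i) (vertex j) = r i j := by
  have hi := vertex_mem_stdSimplex i
  have hj := vertex_mem_stdSimplex j
  obtain ⟨W, hW, hs⟩ := exists_isFlow_flowSize_eq hi hj
  exact le_antisymm
    ((sDis_le_flowCost hr0 hi hj hW hs).trans_eq (hW.flowCost_vertex hr hij hs))
    (le_sDis hi hj fun V hV hVs => (hV.flowCost_vertex hr hij hVs).ge)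

end Vertex

/-- the induced dissimilarity is a semimetric on the standard
simplex extending the original network relationships. -/
theorem induced_dissimilarity_semimetric
    {X : Type*} [Fintype X] [Nonempty X] [LinearOrder X]
(rX : X → X → ℝ)
    (hX0 : ∀ x x', 0 ≤ rX x x') (hXsymm : ∀ x x', rX x x' = rX x' x)
    (hXid : ∀ x x', rX x x' = 0 ↔ x = x') :
    (∀ p ∈ stdSimplex ℝ X, ∀ m ∈ stdSimplex ℝ X, 0 ≤ sDis rX p m) ∧
    (∀ p ∈ stdSimplex ℝ X, ∀ m ∈ stdSimplex ℝ X, sDis rX p m = sDis rX m p) ∧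
    (∀ p ∈ stdSimplex ℝ X, ∀ m ∈ stdSimplex ℝ X, (sDis rX p m = 0 ↔ p = m)) ∧
    (∀ i j : X, sDis rX (vertex i) (vertex j) = rX i j) := by
  refine ⟨fun p _ m _ => sDis_nonneg hX0 p m, fun p _ m _ => sDis_comm rX p m,
    fun p hp m hm => ⟨fun h => ?_, ?_⟩, fun i j => ?_⟩
  · by_contra hpm
    obtain ⟨c, hc, hcr⟩ := exists_pos_forall_ne_le (r := rX) fun i j hij =>
      lt_of_le_of_ne (hX0 i j) fun h0 => hij ((hXid i j).1 h0.symm)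
    have hle : c * halfL1 p m ≤ sDis rX p m := le_sDis hp hm fun W _ hs => by
      rw [← hs]
      exact mul_flowSize_le_flowCost hcr W
    exact (mul_pos hc (halfL1_pos hpm)).not_ge (h ▸ hle)
  · rintro rfl
    exact sDis_self hX0 hp
  · rcases eq_or_ne i j with rfl | hij
    · rw [sDis_self hX0 (vertex_mem_stdSimplex i), (hXid i i).2 rfl]
    · exact sDis_vertex hX0 hXsymm hij
end

section
/- Let N_X = (X, r_X), N_Y = (Y, r_Y) be networks, φ̂ : X → Y a map and φ : S_X → S_Y the induced map. For any points x, x' ∈ S_X and any flow W from x to x', the pushforward W' defined by W'(a, b) = ∑_{i, j ∈ X with φ̂(i) = a, φ̂(j) = b} W(i, j) is a flow from φ(x) to φ(x') whose size is at most the size of W; consequently c_Y(φ(x), φ(x')) ≤ c_X(x, x'). -/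
open scoped BigOperators

/-- The map `φ : S_X → S_Y` induced by `φh : X → Y`:
`(φ x)_i = ∑_{j : φh j = i} x_j`. -/
noncomputable def inducedMap {X Y : Type*} [Fintype X] [DecidableEq Y]
    (φh : X → Y) (u : X → ℝ) : Y → ℝ :=
  fun i => ∑ j, if φh j = i then u j else 0

/-- The pushforward of a function `W : X × X → ℝ` along `f : X → Y`. -/
def flowPushforward {X Y : Type*} [Fintype X] [DecidableEq Y] (f : X → Y) (W : X → X → ℝ) :
    Y → Y → ℝ :=
  fun a b => ∑ i, ∑ j, if f i = a ∧ f j = b then W i j else 0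

theorem sum_flowPushforward_left {X Y : Type*} [Fintype X] [Fintype Y] [DecidableEq Y]
    (f : X → Y) (W : X → X → ℝ) (b : Y) :
    ∑ a, flowPushforward f W a b = ∑ j, if f j = b then ∑ i, W i j else 0 := by
  simp only [flowPushforward, ite_and]
  rw [Finset.sum_comm]
  simp_rw [Finset.sum_comm (s := (Finset.univ : Finset Y)) (t := (Finset.univ : Finset X)),
    Finset.sum_ite_eq, Finset.mem_univ, if_true]
  rw [Finset.sum_comm]
  refine Finset.sum_congr rfl fun j _ => ?_
  split_ifs <;> simp

theorem sum_sum_flowPushforward {X Y : Type*} [Fintype X] [Fintype Y] [DecidableEq Y]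
    (f : X → Y) (W : X → X → ℝ) :
    ∑ a, ∑ b, flowPushforward f W a b = ∑ i, ∑ j, W i j := by
  rw [Finset.sum_comm]
  simp_rw [sum_flowPushforward_left]
  rw [Finset.sum_comm]
  simp_rw [Finset.sum_ite_eq, Finset.mem_univ, if_true]
  rw [Finset.sum_comm]

theorem abs_flowPushforward_le {X Y : Type*} [Fintype X] [DecidableEq Y]
    (f : X → Y) (W : X → X → ℝ) (a b : Y) :
    |flowPushforward f W a b| ≤ flowPushforward f (fun i j => |W i j|) a b := by
  refine (Finset.abs_sum_le_sum_abs _ _).trans (Finset.sum_le_sum fun i _ => ?_)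
  refine (Finset.abs_sum_le_sum_abs _ _).trans (Finset.sum_le_sum fun j _ => ?_)
  split_ifs <;> simp

theorem IsFlow.pushforward {X Y : Type*} [Fintype X] [Fintype Y] [DecidableEq Y]
    (f : X → Y) {p m : X → ℝ} {W : X → X → ℝ} (hW : IsFlow p m W) :
    IsFlow (inducedMap f p) (inducedMap f m) (flowPushforward f W) := by
  refine ⟨fun a b => ?_, fun b => ?_⟩
  · simp only [flowPushforward]
    rw [Finset.sum_comm, ← Finset.sum_neg_distrib]
    refine Finset.sum_congr rfl fun i _ => ?_
    rw [← Finset.sum_neg_distrib]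
    refine Finset.sum_congr rfl fun j _ => ?_
    simp only [and_comm (a := f j = a), hW.1 j i]
    split_ifs <;> simp
  · rw [sum_flowPushforward_left]
    simp only [inducedMap]
    rw [← Finset.sum_add_distrib]
    refine Finset.sum_congr rfl fun i _ => ?_
    rw [hW.2 i]
    split_ifs <;> simp

theorem two_mul_flowSize {X : Type*} [Fintype X] [LinearOrder X] {W : X → X → ℝ}
    (hW : ∀ i j, W i j = - W j i) : 2 * flowSize W = ∑ i, ∑ j, |W i j| := by
  have hswap : flowSize W = ∑ i, ∑ j, if j < i then |W i j| else 0 := by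
    rw [flowSize, Finset.sum_comm]
    refine Finset.sum_congr rfl fun i _ => Finset.sum_congr rfl fun j _ => ?_
    rw [hW j i, abs_neg]
  rw [two_mul]
  nth_rewrite 2 [hswap]
  simp only [flowSize, ← Finset.sum_add_distrib]
  refine Finset.sum_congr rfl fun i _ => Finset.sum_congr rfl fun j _ => ?_
  rcases lt_trichotomy i j with h | rfl | h
  · simp [h, h.not_gt]
  · have : W i i = 0 := by linarith [hW i i]
    simp [this]
  · simp [h, h.not_gt]

theorem flowSize_nonneg {X : Type*} [Fintype X] [LinearOrder X] (W : X → X → ℝ) :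
    0 ≤ flowSize W :=
  Finset.sum_nonneg fun i _ => Finset.sum_nonneg fun j _ => by split_ifs <;> positivity

theorem IsFlow.flowSize_pushforward_le {X Y : Type*} [Fintype X] [LinearOrder X]
    [Fintype Y] [LinearOrder Y] (f : X → Y) {p m : X → ℝ} {W : X → X → ℝ}
    (hW : IsFlow p m W) : flowSize (flowPushforward f W) ≤ flowSize W := by
  have h : 2 * flowSize (flowPushforward f W) ≤ 2 * flowSize W := by
    rw [two_mul_flowSize hW.1, two_mul_flowSize (hW.pushforward f).1,
      ← sum_sum_flowPushforward f fun i j => |W i j|]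
    exact Finset.sum_le_sum fun a _ => Finset.sum_le_sum fun b _ =>
      abs_flowPushforward_le f W a b
  linarith

theorem IsFlow.minCost_le {X : Type*} [Fintype X] [LinearOrder X] {p m : X → ℝ}
    {W : X → X → ℝ} (hW : IsFlow p m W) : minCost p m ≤ flowSize W := by
  refine csInf_le ⟨0, ?_⟩ ⟨W, hW, rfl⟩
  rintro _ ⟨V, -, rfl⟩
  exact flowSize_nonneg V

/-- the pushforward of a flow along an induced map is a flow
between the image points, of size at most the original size; hence the minimal
transformation cost does not increase under induced maps. -/
theorem pushforward_flow
    {X Y : Type*} [Fintype X] [LinearOrder X] [Nonempty X]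
    [Fintype Y] [LinearOrder Y] [Nonempty Y]
(rX : X → X → ℝ) (rY : Y → Y → ℝ)
    (hX0 : ∀ x x', 0 ≤ rX x x') (hXsymm : ∀ x x', rX x x' = rX x' x)
    (hXid : ∀ x x', rX x x' = 0 ↔ x = x')
    (hY0 : ∀ y y', 0 ≤ rY y y') (hYsymm : ∀ y y', rY y y' = rY y' y)
    (hYid : ∀ y y', rY y y' = 0 ↔ y = y')
    (φh : X → Y) (x x' : X → ℝ)
    (hx : x ∈ stdSimplex ℝ X) (hx' : x' ∈ stdSimplex ℝ X)
    (W : X → X → ℝ) (hW : IsFlow x x' W) :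
    IsFlow (inducedMap φh x) (inducedMap φh x')
      (fun a b => ∑ i, ∑ j, if φh i = a ∧ φh j = b then W i j else 0) ∧
    flowSize (fun a b => ∑ i, ∑ j, if φh i = a ∧ φh j = b then W i j else 0)
      ≤ flowSize W ∧
    minCost (inducedMap φh x) (inducedMap φh x') ≤ minCost x x' := by
  refine ⟨hW.pushforward φh, hW.flowSize_pushforward_le φh, le_csInf ⟨_, W, hW, rfl⟩ ?_⟩
  rintro _ ⟨V, hV, rfl⟩
  exact (hV.pushforward φh).minCost_le.trans (hV.flowSize_pushforward_le φh)
end
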